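/- If μ solves (½I + K + L)μ = −(½I + K)σ, where L is the block diagonal operator Lᵢμᵢ(x) = ∫_{Γᵢ} μᵢ ds, then ∫_{Γᵢ} μᵢ ds = 0 for every i and μ solves (½I + K)μ = −(½I + K)σ. -/

import Mathlib

open MeasureTheory Real Filter

noncomputable section

abbrev E2 := EuclideanSpace ℝ (Fin 2)

/-- Kernel of the elastance operator `K`: `∂G(x,y)/∂n_x ds_y` with `x = γ i s` on
`Γ i` and `y = γ j t` on `Γ j`.  Here `∇_x G(x,y) = -(1/2π)(x-y)/|x-y|²`, `n_x` is
the unit outward normal `nrot(γ i)'(s)/‖(γ i)'(s)‖`, and `ds_y = ‖(γ j)'(t)‖ dt`. -/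
def Kker {N : ℕ} (γ : Fin N → ℝ → E2) (i j : Fin N) (s t : ℝ) : ℝ :=
  -(1/(2*π)) * ((γ i s - γ j t) 0 * deriv (γ i) s 1 - (γ i s - γ j t) 1 * deriv (γ i) s 0)
      / (‖γ i s - γ j t‖ ^ 2 * ‖deriv (γ i) s‖) * ‖deriv (γ j) t‖

open scoped Topology

/-- A simple closed regular `C²` curve in the complex plane, parametrized with period `2π`. -/
structure IsRegularSimpleClosed (c : ℝ → ℂ) : Prop where
  contDiff : ContDiff ℝ 2 c
  periodic : Function.Periodic c (2 * π)
  deriv_ne_zero : ∀ t, deriv c t ≠ 0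
  injOn : Set.InjOn c (Set.Ico 0 (2 * π))

/-- The angular velocity of `c` as seen from the point `y`. -/
def angularVelocity (c : ℝ → ℂ) (y : ℂ) (s : ℝ) : ℝ := (deriv c s / (c s - y)).im

/-- The total angle swept by `c` over one period, as seen from the point `y`. -/
def sweptAngle (c : ℝ → ℂ) (y : ℂ) : ℝ := ∫ s in (0:ℝ)..(2 * π), angularVelocity c y s

theorem hasDerivAt_arg_div {c : ℝ → ℂ} {s : ℝ} {y z : ℂ} (hc : DifferentiableAt ℝ c s)
    (hy : c s ≠ y) (hz : c s ≠ z) (hs : (c s - y) / (c s - z) ∈ Complex.slitPlane) :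
    HasDerivAt (fun u => ((c u - y) / (c u - z)).arg)
      (angularVelocity c y s - angularVelocity c z s) s := by
  have h1 : HasDerivAt (fun u => c u - y) (deriv c s) s := hc.hasDerivAt.sub_const y
  have h2 : HasDerivAt (fun u => c u - z) (deriv c s) s := hc.hasDerivAt.sub_const z
  have hy' := sub_ne_zero.2 hy
  have hz' := sub_ne_zero.2 hz
  have h3 := (h1.div h2 hz').clog_real hs
  have h4 := (Complex.imCLM.hasFDerivAt.comp_hasDerivAt s h3)
  refine (h4.congr_deriv ?_).congr_of_eventuallyEq (Eventually.of_forall fun u => ?_)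
  · simp only [angularVelocity, Complex.imCLM_apply, ← Complex.sub_im]
    congr 1
    simp only [Pi.div_apply]
    field_simp
  · simp [Complex.log_im]

namespace IsRegularSimpleClosed

variable {c : ℝ → ℂ}

theorem differentiable (hc : IsRegularSimpleClosed c) : Differentiable ℝ c :=
  hc.contDiff.differentiable (by norm_num)

theorem continuous (hc : IsRegularSimpleClosed c) : Continuous c := hc.contDiff.continuous

theorem contDiff_deriv (hc : IsRegularSimpleClosed c) : ContDiff ℝ 1 (deriv c) := by
  have h := hc.contDiff
  rw [show (2 : WithTop ℕ∞) = 1 + 1 by norm_num, contDiff_succ_iff_deriv] at h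
  exact h.2.2

theorem continuous_deriv (hc : IsRegularSimpleClosed c) : Continuous (deriv c) :=
  hc.contDiff_deriv.continuous

theorem periodic_deriv (hc : IsRegularSimpleClosed c) : Function.Periodic (deriv c) (2 * π) := by
  intro t
  rw [← deriv_comp_add_const]
  congr 1
  exact funext hc.periodic

theorem periodic_angularVelocity (hc : IsRegularSimpleClosed c) (y : ℂ) :
    Function.Periodic (angularVelocity c y) (2 * π) := fun t => by
  simp only [angularVelocity, hc.periodic t, hc.periodic_deriv t]

theorem range_eq (hc : IsRegularSimpleClosed c) : Set.range c = c '' Set.Icc 0 (2 * π) := by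
  rw [← hc.periodic.image_Icc (by positivity) 0, zero_add]

theorem isCompact_range (hc : IsRegularSimpleClosed c) : IsCompact (Set.range c) :=
  hc.range_eq ▸ isCompact_Icc.image hc.continuous

theorem exists_eq_add (hc : IsRegularSimpleClosed c) {s t : ℝ} (h : c s = c t) :
    ∃ n : ℤ, s = t + n * (2 * π) := by
  have hp := Real.two_pi_pos
  obtain ⟨m, hm, -⟩ := existsUnique_add_zsmul_mem_Ico hp s 0
  obtain ⟨k, hk, -⟩ := existsUnique_add_zsmul_mem_Ico hp t 0
  rw [zero_add] at hm hk
  have := hc.injOn hm hk (by simp only [hc.periodic.zsmul m s, hc.periodic.zsmul k t, h])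
  refine ⟨k - m, ?_⟩
  simp only [zsmul_eq_mul] at this
  push_cast
  linarith

theorem continuous_angularVelocity (hc : IsRegularSimpleClosed c) {y : ℂ} (hy : y ∉ Set.range c) :
    Continuous (angularVelocity c y) :=
  Complex.continuous_im.comp (hc.continuous_deriv.div (hc.continuous.sub continuous_const)
    fun s hs => hy ⟨s, sub_eq_zero.1 hs⟩)

theorem eventually_sweptAngle_eq (hc : IsRegularSimpleClosed c) {y : ℂ} (hy : y ∉ Set.range c) :
    ∀ᶠ z in 𝓝 y, sweptAngle c z = sweptAngle c y := by
  have hcl := hc.isCompact_range.isClosed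
  have hd : 0 < Metric.infDist y (Set.range c) :=
    (hcl.notMem_iff_infDist_pos (Set.range_nonempty c)).1 hy
  filter_upwards [Metric.ball_mem_nhds y hd] with z hz
  have hlt : ∀ s, ‖y - z‖ < ‖c s - y‖ := fun s => by
    rw [← dist_eq_norm, ← dist_eq_norm, dist_comm y z, dist_comm (c s) y]
    exact (Metric.mem_ball.1 hz).trans_le (Metric.infDist_le_dist_of_mem ⟨s, rfl⟩)
  have hsy : ∀ s, c s ≠ y := fun s h => hy ⟨s, h⟩
  have hsz : ∀ s, c s ≠ z := fun s h => by
    have := hlt s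
    rw [h, norm_sub_rev] at this
    exact lt_irrefl _ this
  have hslit : ∀ s, (c s - z) / (c s - y) ∈ Complex.slitPlane := fun s => by
    have hne := sub_ne_zero.2 (hsy s)
    have : (c s - z) / (c s - y) = 1 + (y - z) / (c s - y) := by field_simp; ring
    rw [this]
    refine Complex.mem_slitPlane_of_norm_lt_one ?_
    rw [norm_div]
    exact (div_lt_one (norm_pos_iff.2 hne)).2 (hlt s)
  have hz' : z ∉ Set.range c := fun ⟨s, hs⟩ => hsz s hs
  have key := intervalIntegral.integral_eq_sub_of_hasDerivAt (a := 0) (b := 2 * π)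
    (fun s _ => hasDerivAt_arg_div (hc.differentiable s) (hsz s) (hsy s) (hslit s))
    (((hc.continuous_angularVelocity hz').sub
      (hc.continuous_angularVelocity hy)).intervalIntegrable _ _)
  rw [intervalIntegral.integral_sub ((hc.continuous_angularVelocity hz').intervalIntegrable _ _)
    ((hc.continuous_angularVelocity hy).intervalIntegrable _ _)] at key
  have h0 : c (2 * π) = c 0 := by simpa using hc.periodic 0
  rw [h0, sub_self] at key
  exact sub_eq_zero.1 key

/-- The chord of a `C²` curve is tangent to second order, so the angular velocity seen from
points of the curve itself is locally bounded across the diagonal. -/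
theorem eventually_abs_angularVelocity_le_diag (hc : IsRegularSimpleClosed c) (t₀ : ℝ) :
    ∃ C, ∀ᶠ p : ℝ × ℝ in 𝓝 (t₀, t₀), |angularVelocity c (c p.2) p.1| ≤ C := by
  obtain ⟨K, U, hU, hK⟩ := (hc.contDiff_deriv.contDiffAt (x := t₀)).exists_lipschitzOnWith
  obtain ⟨ε, hε, hεU⟩ := Metric.mem_nhds_iff.1 hU
  have hstrict : HasStrictDerivAt c (deriv c t₀) t₀ :=
    (hc.contDiff.contDiffAt (x := t₀)).hasStrictDerivAt (by norm_num)
  set m := ‖deriv c t₀‖ with hm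
  have hm0 : 0 < m := norm_pos_iff.2 (hc.deriv_ne_zero t₀)
  have hlow := (hasStrictDerivAt_iff_hasStrictFDerivAt.1 hstrict).isLittleO.def (half_pos hm0)
  have hball : ∀ᶠ p : ℝ × ℝ in 𝓝 (t₀, t₀), p.1 ∈ Metric.ball t₀ ε ∧ p.2 ∈ Metric.ball t₀ ε := by
    rw [nhds_prod_eq]
    exact prod_mem_prod (Metric.ball_mem_nhds t₀ hε) (Metric.ball_mem_nhds t₀ hε)
  refine ⟨2 * K / m, ?_⟩
  filter_upwards [hlow, hball] with p hp hpb
  obtain ⟨s, t⟩ := p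
  obtain ⟨hs, ht⟩ := hpb
  simp only at hp hs ht ⊢
  rcases eq_or_ne s t with rfl | hst
  · simp only [angularVelocity, sub_self, div_zero, Complex.zero_im, abs_zero]
    positivity
  have hu : 0 < |s - t| := abs_pos.2 (sub_ne_zero.2 hst)
  have hchord : m / 2 * |s - t| ≤ ‖c s - c t‖ := by
    have h1 : ‖((s - t : ℝ) : ℂ) * deriv c t₀‖ = |s - t| * m := by
      rw [norm_mul, Complex.norm_real, Real.norm_eq_abs]
    have h2 := norm_sub_norm_le (((s - t : ℝ) : ℂ) * deriv c t₀) (c s - c t)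
    rw [norm_sub_rev (_ * _), h1] at h2
    simp only [ContinuousLinearMap.toSpanSingleton_apply, Complex.real_smul, Real.norm_eq_abs] at hp
    linarith
  have herr : ‖c s - c t - ((s - t : ℝ) : ℂ) * deriv c s‖ ≤ K * |s - t| * |s - t| := by
    have hsub : Set.uIcc s t ⊆ U := fun x hx =>
      hεU ((convex_ball t₀ ε).ordConnected.uIcc_subset hs ht hx)
    have hd : ∀ x ∈ Set.uIcc s t, HasDerivWithinAt (fun x : ℝ => c x - (x : ℂ) * deriv c s)
        (deriv c x - 1 * deriv c s) (Set.uIcc s t) x := fun x _ =>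
      (((hc.differentiable x).hasDerivAt).sub
        ((Complex.ofRealCLM.hasDerivAt (x := x)).mul_const _)).hasDerivWithinAt
    have hb : ∀ x ∈ Set.uIcc s t, ‖deriv c x - 1 * deriv c s‖ ≤ K * |s - t| := fun x hx => by
      rw [one_mul, ← dist_eq_norm]
      refine (hK.dist_le_mul x (hsub hx) s (hsub Set.left_mem_uIcc)).trans ?_
      gcongr
      rw [Real.dist_eq, abs_sub_comm s t]
      exact Set.abs_sub_left_of_mem_uIcc hx
    have := (convex_uIcc s t).norm_image_sub_le_of_norm_hasDerivWithin_le hd hb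
      Set.right_mem_uIcc Set.left_mem_uIcc
    rw [Real.norm_eq_abs] at this
    refine le_of_eq_of_le (congrArg norm ?_) this
    push_cast
    ring
  have hu0 : ((s - t : ℝ) : ℂ) ≠ 0 := Complex.ofReal_ne_zero.2 (sub_ne_zero.2 hst)
  have hd0 : c s - c t ≠ 0 := norm_pos_iff.1 (lt_of_lt_of_le (by positivity) hchord)
  have him : angularVelocity c (c t) s
      = (-(c s - c t - ((s - t : ℝ) : ℂ) * deriv c s) / (((s - t : ℝ) : ℂ) * (c s - c t))).im := by
    have : -(c s - c t - ((s - t : ℝ) : ℂ) * deriv c s) / (((s - t : ℝ) : ℂ) * (c s - c t))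
        = deriv c s / (c s - c t) - ((s - t : ℝ) : ℂ)⁻¹ := by
      field_simp
      ring
    rw [this, Complex.sub_im, ← Complex.ofReal_inv, Complex.ofReal_im, sub_zero, angularVelocity]
  rw [him]
  refine (Complex.abs_im_le_norm _).trans ?_
  rw [norm_div, norm_neg, norm_mul, Complex.norm_real, Real.norm_eq_abs,
    div_le_div_iff₀ (by positivity) hm0]
  calc _ ≤ K * |s - t| * |s - t| * m := by gcongr
    _ = 2 * K * (|s - t| * (m / 2 * |s - t|)) := by ring
    _ ≤ _ := by gcongr

theorem continuousAt_angularVelocity (hc : IsRegularSimpleClosed c) {s t : ℝ} (h : c s ≠ c t) :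
    ContinuousAt (fun p : ℝ × ℝ => angularVelocity c (c p.2) p.1) (s, t) := by
  have h1 := (hc.continuous_deriv.comp continuous_fst).continuousAt (x := (s, t))
  have h2 := ((hc.continuous.comp continuous_fst).sub
    (hc.continuous.comp continuous_snd)).continuousAt (x := (s, t))
  exact Complex.continuous_im.continuousAt.comp (h1.div h2 (sub_ne_zero.2 h))

theorem exists_abs_angularVelocity_le (hc : IsRegularSimpleClosed c) (a b : ℝ) :
    ∃ C, ∀ s ∈ Set.Icc a b, ∀ t ∈ Set.Icc a b, |angularVelocity c (c t) s| ≤ C := by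
  suffices h : ∃ C, ∀ p ∈ Set.Icc a b ×ˢ Set.Icc a b, |angularVelocity c (c p.2) p.1| ≤ C by
    obtain ⟨C, hC⟩ := h
    exact ⟨C, fun s hs t ht => hC (s, t) ⟨hs, ht⟩⟩
  refine (isCompact_Icc.prod isCompact_Icc).induction_on
    (p := fun S => ∃ C, ∀ p ∈ S, |angularVelocity c (c p.2) p.1| ≤ C)
    ⟨0, by simp⟩ ?_ ?_ ?_
  · rintro S T hST ⟨C, hC⟩
    exact ⟨C, fun p hp => hC p (hST hp)⟩
  · rintro S T ⟨C, hC⟩ ⟨C', hC'⟩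
    refine ⟨max C C', ?_⟩
    rintro p (hp | hp)
    exacts [(hC p hp).trans (le_max_left _ _), (hC' p hp).trans (le_max_right _ _)]
  · rintro ⟨s, t⟩ -
    suffices h : ∃ C, ∀ᶠ p : ℝ × ℝ in 𝓝 (s, t), |angularVelocity c (c p.2) p.1| ≤ C by
      obtain ⟨C, hC⟩ := h
      exact ⟨_, mem_nhdsWithin_of_mem_nhds hC, C, fun p hp => hp⟩
    by_cases h : c s = c t
    · obtain ⟨n, rfl⟩ := hc.exists_eq_add h
      obtain ⟨C, hC⟩ := hc.eventually_abs_angularVelocity_le_diag t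
      refine ⟨C, ?_⟩
      have hcont : Tendsto (fun p : ℝ × ℝ => (p.1 - n * (2 * π), p.2))
          (𝓝 (t + n * (2 * π), t)) (𝓝 (t, t)) := by
        have : Continuous (fun p : ℝ × ℝ => (p.1 - n * (2 * π), p.2)) := by fun_prop
        simpa using this.tendsto (t + n * (2 * π), t)
      filter_upwards [hcont.eventually hC] with p hp
      simpa only [(hc.periodic_angularVelocity _).sub_int_mul_eq n] using hp
    · have hev := ((hc.continuousAt_angularVelocity h).abs).eventually
        (eventually_le_nhds (lt_add_one |angularVelocity c (c t) s|))
      exact ⟨_, hev⟩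

theorem measurable_angularVelocity (hc : IsRegularSimpleClosed c) :
    Measurable (fun p : ℂ × ℝ => angularVelocity c p.1 p.2) := by
  have h1 := hc.continuous_deriv.measurable
  have h2 := hc.continuous.measurable
  unfold angularVelocity
  fun_prop

theorem intervalIntegrable_angularVelocity (hc : IsRegularSimpleClosed c) (t a b : ℝ) :
    IntervalIntegrable (angularVelocity c (c t)) volume a b := by
  obtain ⟨C, hC⟩ := hc.exists_abs_angularVelocity_le (min t (min a b)) (max t (max a b))
  have hmeas : Measurable (angularVelocity c (c t)) :=
    hc.measurable_angularVelocity.comp measurable_prodMk_left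
  refine (intervalIntegrable_const (c := C)).mono_fun' hmeas.aestronglyMeasurable ?_
  refine (ae_restrict_iff' measurableSet_uIoc).2 (Eventually.of_forall fun s hs => ?_)
  have := Set.uIoc_subset_uIcc hs
  exact hC s ⟨(min_le_right _ _).trans this.1, this.2.trans (le_max_right _ _)⟩ t
    ⟨min_le_left _ _, le_max_left _ _⟩

theorem sweptAngle_eq (hc : IsRegularSimpleClosed c) (y : ℂ) (t : ℝ) :
    sweptAngle c y = ∫ s in t..(t + 2 * π), angularVelocity c y s := by
  have := (hc.periodic_angularVelocity y).intervalIntegral_add_eq t 0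
  rw [zero_add] at this
  exact this.symm

end IsRegularSimpleClosed
namespace IsRegularSimpleClosed

variable {c : ℝ → ℂ}

theorem tendsto_arg_div (hc : IsRegularSimpleClosed c) {t ρ κ : ℝ} {l : Filter ℝ} (hρ : ρ ≠ 0)
    (hκ : κ = 1 ∨ κ = -1) (hl : l ≤ 𝓝[≠] t) (hpos : ∀ᶠ s in l, 0 < κ * (s - t) / ρ) :
    Tendsto (fun s => ((c s - (c t + ρ * Complex.I * deriv c t)) / (c s - c t)).arg) l
      (𝓝 (-(κ * (π / 2)))) := by
  have hT := hc.deriv_ne_zero t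
  have hslope := ((hasDerivAt_iff_tendsto_slope.1 (hc.differentiable t).hasDerivAt).mono_left hl)
  have hid : Tendsto (fun s : ℝ => ((s : ℝ) : ℂ)) l (𝓝 (t : ℂ)) :=
    (Complex.continuous_ofReal.tendsto t).mono_left (hl.trans nhdsWithin_le_nhds)
  have hρ' : (ρ : ℂ) ≠ 0 := Complex.ofReal_ne_zero.2 hρ
  have hlim : Tendsto (fun s : ℝ => (κ / ρ : ℂ) * ((s - t : ℂ)
      - ρ * Complex.I * deriv c t * (slope c t s)⁻¹)) l (𝓝 (-(κ * Complex.I))) := by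
    have := ((hid.sub_const (t : ℂ)).sub
      ((hslope.inv₀ hT).const_mul (ρ * Complex.I * deriv c t))).const_mul (κ / ρ : ℂ)
    convert this using 2
    field_simp
    ring
  have hmem : -(κ * Complex.I) ∈ Complex.slitPlane := by
    rcases hκ with rfl | rfl <;> simp [Complex.slitPlane]
  have harg : (-(κ * Complex.I)).arg = -(κ * (π / 2)) := by
    rcases hκ with rfl | rfl <;> simp
  rw [← harg]
  refine ((Complex.continuousAt_arg hmem).tendsto.comp hlim).congr' ?_
  have hne : ∀ᶠ s in l, s ≠ t := hl self_mem_nhdsWithin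
  have hcne : ∀ᶠ s in l, slope c t s ≠ 0 := hslope.eventually_ne hT
  filter_upwards [hpos, hne, hcne] with s hs hst hsl
  rw [Function.comp_apply, ← Complex.arg_real_mul (_ / (c s - c t)) hs]
  congr 1
  have hst' : (s - t : ℂ) ≠ 0 := by exact_mod_cast sub_ne_zero.2 hst
  have hsc : slope c t s = (c s - c t) / (s - t) := by
    rw [slope_def_module, Complex.real_smul, div_eq_inv_mul]
    push_cast
    rfl
  rw [hsc] at hsl ⊢
  have hcs : c s - c t ≠ 0 := fun h => hsl (by rw [h, zero_div])
  push_cast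
  field_simp
  ring

theorem sweptAngle_sub (hc : IsRegularSimpleClosed c) {t ρ κ : ℝ}
    (hκ : κ = 1 ∨ κ = -1) (hκρ : 0 < κ * ρ)
    (hseg : ∀ τ : ℝ, 0 < τ → τ ≤ 1 → c t + (τ * ρ : ℝ) * Complex.I * deriv c t ∉ Set.range c) :
    sweptAngle c (c t + ρ * Complex.I * deriv c t) - sweptAngle c (c t) = κ * π := by
  have hρ : ρ ≠ 0 := fun h => by simp [h] at hκρ
  set y := c t + ρ * Complex.I * deriv c t with hy
  have hyΓ : y ∉ Set.range c := by simpa using hseg 1 one_pos le_rfl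
  have hp := Real.two_pi_pos
  have hne : ∀ s ∈ Set.Ioo t (t + 2 * π), c s ≠ c t := fun s hs h => by
    obtain ⟨n, rfl⟩ := hc.exists_eq_add h
    have h1 : (0 : ℝ) < n := by nlinarith [hs.1]
    have h2 : (n : ℝ) < 1 := by nlinarith [hs.2]
    have h1' : 0 < n := by exact_mod_cast h1
    have h2' : n < 1 := by exact_mod_cast h2
    omega
  have hslit : ∀ s ∈ Set.Ioo t (t + 2 * π), (c s - y) / (c s - c t) ∈ Complex.slitPlane := by
    intro s hs
    by_contra hn
    have hd := sub_ne_zero.2 (hne s hs)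
    rw [Complex.mem_slitPlane_iff_not_le_zero, not_not, Complex.le_def] at hn
    obtain ⟨hre, him⟩ := hn
    set k : ℝ := -((c s - y) / (c s - c t)).re with hk
    have hk0 : 0 ≤ k := neg_nonneg.2 hre
    have hq : (c s - y) / (c s - c t) = ((-k : ℝ) : ℂ) := by
      apply Complex.ext
      · simp [hk]
      · simpa using him
    rw [div_eq_iff hd] at hq
    refine hseg (1 / (1 + k)) (by positivity) ((div_le_one (by positivity)).2 (by linarith)) ⟨s, ?_⟩
    have h1k : (1 + k : ℂ) ≠ 0 := by exact_mod_cast (by positivity : (1 + k : ℝ) ≠ 0)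
    push_cast at hq ⊢
    field_simp
    rw [hy] at hq
    linear_combination hq
  have hsub := (hc.continuous_angularVelocity hyΓ).intervalIntegrable (μ := volume) t (t + 2 * π)
  have hcont := hc.intervalIntegrable_angularVelocity t t (t + 2 * π)
  have hκ' : -κ = 1 ∨ -κ = -1 := by rcases hκ with rfl | rfl <;> simp
  have hright : Tendsto (fun s => ((c s - y) / (c s - c t)).arg) (𝓝[>] t)
      (𝓝 (-(κ * (π / 2)))) := by
    refine hc.tendsto_arg_div hρ hκ (nhdsWithin_mono _ fun s hs => ne_of_gt hs) ?_
    filter_upwards [self_mem_nhdsWithin] with s hs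
    have : 0 < s - t := sub_pos.2 hs
    rw [show κ * (s - t) / ρ = (s - t) * (κ * ρ) / ρ ^ 2 by field_simp]
    positivity
  have hleft₀ : Tendsto (fun s => ((c s - y) / (c s - c t)).arg) (𝓝[<] t)
      (𝓝 (-(-κ * (π / 2)))) := by
    refine hc.tendsto_arg_div hρ hκ' (nhdsWithin_mono _ fun s hs => ne_of_lt hs) ?_
    filter_upwards [self_mem_nhdsWithin] with s hs
    have : 0 < t - s := sub_pos.2 hs
    rw [show -κ * (s - t) / ρ = (t - s) * (κ * ρ) / ρ ^ 2 by field_simp; ring]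
    positivity
  have hshift : Tendsto (fun s => s - 2 * π) (𝓝[<] (t + 2 * π)) (𝓝[<] t) := by
    refine tendsto_nhdsWithin_iff.2 ⟨?_, ?_⟩
    · have : Continuous fun s : ℝ => s - 2 * π := by fun_prop
      simpa using (this.tendsto (t + 2 * π)).mono_left nhdsWithin_le_nhds
    · filter_upwards [self_mem_nhdsWithin] with s hs
      exact sub_lt_iff_lt_add.2 (by simpa [add_comm] using hs)
  have hleft : Tendsto (fun s => ((c s - y) / (c s - c t)).arg) (𝓝[<] (t + 2 * π))
      (𝓝 (-(-κ * (π / 2)))) := by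
    refine (hleft₀.comp hshift).congr fun s => ?_
    simp only [Function.comp_apply, hc.periodic.sub_eq]
  have key := intervalIntegral.integral_eq_sub_of_hasDerivAt_of_tendsto (a := t) (b := t + 2 * π)
    (by linarith) (fun s hs => hasDerivAt_arg_div (hc.differentiable s)
      (fun h => hyΓ ⟨s, h⟩) (hne s hs) (hslit s hs)) (hsub.sub hcont) hright hleft
  rw [intervalIntegral.integral_sub hsub hcont, ← hc.sweptAngle_eq, ← hc.sweptAngle_eq] at key
  rw [key]
  ring

end IsRegularSimpleClosed

/-- The point at (unnormalized) distance `p.2` along the normal to `c` at time `p.1`. -/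
def normalPush (c : ℝ → ℂ) (p : ℝ × ℝ) : ℂ := c p.1 + p.2 * Complex.I * deriv c p.1

/-- The normal coordinates of radius `δ` about time `t` form a tube around an arc of `c`. -/
structure IsTube (c : ℝ → ℂ) (t δ : ℝ) : Prop where
  pos : 0 < δ
  isOpen : IsOpen (normalPush c '' Metric.ball (t, 0) δ)
  eq_zero : ∀ p ∈ Metric.ball (t, (0 : ℝ)) δ, normalPush c p ∈ Set.range c → p.2 = 0

namespace IsRegularSimpleClosed

variable {c : ℝ → ℂ}

theorem contDiff_normalPush (hc : IsRegularSimpleClosed c) : ContDiff ℝ 1 (normalPush c) := by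
  have h1 : ContDiff ℝ 1 c := hc.contDiff.of_le (by norm_num)
  have h2 := hc.contDiff_deriv
  have h3 : ContDiff ℝ 1 (fun p : ℝ × ℝ => (p.2 : ℂ)) := Complex.ofRealCLM.contDiff.comp contDiff_snd
  exact (h1.comp contDiff_fst).add ((h3.mul contDiff_const).mul (h2.comp contDiff_fst))

theorem hasFDerivAt_normalPush (hc : IsRegularSimpleClosed c) (t : ℝ) :
    HasFDerivAt (normalPush c) ((Complex.equivRealProdCLM.symm.trans
      (ContinuousLinearEquiv.smulLeft (Units.mk0 _ (hc.deriv_ne_zero t))) : (ℝ × ℝ) ≃L[ℝ] ℂ) :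
      (ℝ × ℝ) →L[ℝ] ℂ) (t, 0) := by
  have h1 : HasFDerivAt (fun p : ℝ × ℝ => c p.1) _ (t, 0) :=
    (hc.differentiable t).hasFDerivAt.comp (t, (0:ℝ)) hasFDerivAt_fst
  have hd : DifferentiableAt ℝ (deriv c) t := hc.contDiff_deriv.differentiable one_ne_zero t
  have h2 : HasFDerivAt (fun p : ℝ × ℝ => deriv c p.1) _ (t, 0) :=
    HasFDerivAt.comp (g := deriv c) (f := Prod.fst) (t, (0:ℝ)) hd.hasFDerivAt hasFDerivAt_fst
  have h3 : HasFDerivAt (fun p : ℝ × ℝ => (p.2 : ℂ) * Complex.I) _ (t, 0) :=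
    (Complex.ofRealCLM.hasFDerivAt.comp (t, (0:ℝ)) hasFDerivAt_snd).mul_const Complex.I
  refine (h1.add (h3.mul h2)).congr_fderiv ?_
  ext
  · simp [Complex.equivRealProdCLM_symm_apply, Units.smul_def]
  · simp [Complex.equivRealProdCLM_symm_apply, Units.smul_def, mul_comm]

theorem exists_isTube (hc : IsRegularSimpleClosed c) (t : ℝ) : ∃ δ, IsTube c t δ := by
  set e := (hc.contDiff_normalPush.contDiffAt (x := (t, 0))).toOpenPartialHomeomorph _
    (hc.hasFDerivAt_normalPush t) one_ne_zero with he
  have hsrc : (t, (0:ℝ)) ∈ e.source := ContDiffAt.mem_toOpenPartialHomeomorph_source _ _ _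
  have hcoe : (e : ℝ × ℝ → ℂ) = normalPush c := ContDiffAt.toOpenPartialHomeomorph_coe _ _ _
  obtain ⟨ε, hε, hεs⟩ := Metric.isOpen_iff.1 e.open_source _ hsrc
  set F := c '' (Set.Icc (t - π) (t + π) \ Metric.ball t ε) with hF
  have hFc : IsClosed F :=
    ((isCompact_Icc.diff Metric.isOpen_ball).image hc.continuous).isClosed
  have hπ := Real.pi_pos
  have htF : c t ∉ F := by
    rintro ⟨s, ⟨hs, hsε⟩, hst⟩
    obtain ⟨n, rfl⟩ := hc.exists_eq_add hst
    have h1 : (-1 : ℝ) < n := by nlinarith [hs.1]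
    have h2 : (n : ℝ) < 1 := by nlinarith [hs.2]
    have h1' : -1 < n := by exact_mod_cast h1
    have h2' : n < 1 := by exact_mod_cast h2
    obtain rfl : n = 0 := by omega
    exact hsε (by simpa using hε)
  have h0 : normalPush c (t, 0) = c t := by simp [normalPush]
  have hev : ∀ᶠ p in 𝓝 (t, (0:ℝ)), normalPush c p ∉ F := by
    refine hc.contDiff_normalPush.continuous.continuousAt.eventually_mem (hFc.isOpen_compl.mem_nhds ?_)
    rw [h0]; exact htF
  obtain ⟨δ, hδ, hδF⟩ := Metric.eventually_nhds_iff_ball.1 hev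
  refine ⟨min δ ε, lt_min hδ hε, ?_, fun p hp ⟨s, hs⟩ => ?_⟩
  · rw [← hcoe]
    exact e.isOpen_image_of_subset_source Metric.isOpen_ball
      ((Metric.ball_subset_ball (min_le_right _ _)).trans hεs)
  · obtain ⟨n, hn, -⟩ := existsUnique_add_zsmul_mem_Ico Real.two_pi_pos s (t - π)
    set u := s + n • (2 * π) with hu
    have hus : c u = normalPush c p := by rw [hu, hc.periodic.zsmul n s, hs]
    have hut : u ∈ Metric.ball t ε := by
      by_contra hnot
      refine hδF p (Metric.ball_subset_ball (min_le_left _ _) hp) ⟨u, ⟨⟨hn.1, ?_⟩, hnot⟩, hus⟩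
      linarith [hn.2]
    have hmem : (u, (0:ℝ)) ∈ e.source := hεs (by
      rw [← ball_prod_same]; exact ⟨hut, Metric.mem_ball_self hε⟩)
    have := e.injOn (hεs (Metric.ball_subset_ball (min_le_right _ _) hp)) hmem (by
      rw [hcoe, ← hus]; simp [normalPush])
    rw [this]

theorem exists_eq_on_side (hc : IsRegularSimpleClosed c) {f : ℂ → ℝ}
    (hf : ∀ y ∉ Set.range c, ∀ᶠ z in 𝓝 y, f z = f y) {κ : ℝ} (hκ : κ ≠ 0) :
    ∃ a, ∀ t δ, IsTube c t δ → ∀ p ∈ Metric.ball (t, (0:ℝ)) δ, 0 < κ * p.2 →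
      f (normalPush c p) = a := by
  have hloc : ∀ t δ, IsTube c t δ → ∃ a, ∀ p ∈ Metric.ball (t, (0:ℝ)) δ, 0 < κ * p.2 →
      f (normalPush c p) = a := by
    intro t δ hδ
    have hconv : Convex ℝ (Metric.ball (t, (0:ℝ)) δ ∩ {p | 0 < κ * p.2}) := by
      refine (convex_ball _ _).inter ?_
      exact convex_halfSpace_gt (f := fun p : ℝ × ℝ => κ * p.2)
        ⟨fun p q => by simp [mul_add], fun r p => by simp [mul_left_comm]⟩ 0
    have hlc : ∀ p ∈ Metric.ball (t, (0:ℝ)) δ ∩ {p | 0 < κ * p.2},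
        ∀ᶠ q in 𝓝 p, f (normalPush c q) = f (normalPush c p) := fun p hp =>
      hc.contDiff_normalPush.continuous.continuousAt.eventually (hf _ fun h => by
        have := hδ.eq_zero p hp.1 h
        have h2 : 0 < κ * p.2 := hp.2
        simp [this] at h2)
    set S := Metric.ball (t, (0:ℝ)) δ ∩ {p | 0 < κ * p.2} with hS
    have : PreconnectedSpace S := Subtype.preconnectedSpace hconv.isPreconnected
    have hlocS : IsLocallyConstant fun p : S => f (normalPush c p) :=
      (IsLocallyConstant.iff_eventually_eq _).2 fun p =>
        continuous_subtype_val.continuousAt.eventually (hlc p p.2)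
    rcases S.eq_empty_or_nonempty with h | ⟨q, hq⟩
    · exact ⟨0, fun p hp hp' => absurd (show p ∈ S from ⟨hp, hp'⟩) (h ▸ Set.notMem_empty p)⟩
    · exact ⟨f (normalPush c q), fun p hp hp' =>
        hlocS.apply_eq_of_isPreconnected isPreconnected_univ (x := ⟨p, hp, hp'⟩) (y := ⟨q, hq⟩)
          trivial trivial⟩
  choose δ hδ using hc.exists_isTube
  choose a ha using fun t => hloc t (δ t) (hδ t)
  have hcompare : ∀ t r, IsTube c t r → ∀ b, (∀ p ∈ Metric.ball (t, (0:ℝ)) r, 0 < κ * p.2 →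
      f (normalPush c p) = b) → ∀ u ∈ Metric.ball t r, a u = b := by
    intro t r hr b hb u hu
    set m := min r (δ u) with hm
    have hm0 : 0 < m := lt_min hr.pos (hδ u).pos
    set h := m / 2 * (κ / |κ|) with hh
    have hκa : 0 < |κ| := abs_pos.2 hκ
    have hpos : 0 < κ * h := by
      have : κ * h = m / 2 * (κ ^ 2 / |κ|) := by rw [hh]; ring
      rw [this]; positivity
    have habs : |h| < m := by
      have hone : |(κ / |κ|)| = 1 := by rw [abs_div, abs_abs, div_self hκa.ne']
      rw [hh, abs_mul, hone, mul_one, abs_of_pos (by positivity)]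
      linarith
    rw [← ha u (u, h) ?_ hpos, hb (u, h) ?_ hpos]
    · rw [← ball_prod_same]
      exact ⟨hu, by simpa using habs.trans_le (min_le_left _ _)⟩
    · rw [← ball_prod_same]
      exact ⟨Metric.mem_ball_self (hδ u).pos, by simpa using habs.trans_le (min_le_right _ _)⟩
  have hconst : IsLocallyConstant a := (IsLocallyConstant.iff_eventually_eq _).2 fun t => by
    filter_upwards [Metric.ball_mem_nhds t (hδ t).pos] with u hu
    exact hcompare t (δ t) (hδ t) (a t) (ha t) u hu
  refine ⟨a 0, fun t r hr p hp hpos => ?_⟩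
  obtain ⟨b, hb⟩ := hloc t r hr
  rw [hb p hp hpos, ← hcompare t r hr b hb t (Metric.mem_ball_self hr.pos)]
  exact hconst.apply_eq_of_isPreconnected isPreconnected_univ trivial trivial

end IsRegularSimpleClosed
namespace IsRegularSimpleClosed

variable {c : ℝ → ℂ}

theorem tendsto_sweptAngle_cocompact (hc : IsRegularSimpleClosed c) :
    Tendsto (sweptAngle c) (cocompact ℂ) (𝓝 0) := by
  obtain ⟨R, hR⟩ := hc.isCompact_range.isBounded.exists_norm_le
  obtain ⟨M, hM⟩ := isCompact_Icc.exists_bound_of_continuousOn (s := Set.Icc 0 (2 * π))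
    hc.continuous_deriv.continuousOn
  have hp := Real.two_pi_pos
  have hlim : Tendsto (fun y : ℂ => M / (‖y‖ - R) * |2 * π - 0|) (cocompact ℂ) (𝓝 0) := by
    have h1 : Tendsto (fun y : ℂ => ‖y‖ - R) (cocompact ℂ) atTop :=
      tendsto_atTop_add_const_right _ _ (tendsto_norm_cocompact_atTop (E := ℂ))
    simpa using (h1.const_div_atTop M).mul_const |2 * π - 0|
  refine squeeze_zero_norm' ?_ hlim
  filter_upwards [(tendsto_norm_cocompact_atTop (E := ℂ)).eventually_gt_atTop R] with y hy
  refine intervalIntegral.norm_integral_le_of_norm_le_const fun s hs => ?_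
  rw [Set.uIoc_of_le hp.le] at hs
  refine (Complex.abs_im_le_norm _).trans ?_
  rw [norm_div]
  have h1 : ‖y‖ - R ≤ ‖c s - y‖ := by
    have h2 := norm_sub_norm_le y (c s)
    rw [norm_sub_rev] at h2
    linarith [hR _ ⟨s, rfl⟩]
  have h3 := hM s ⟨hs.1.le, hs.2⟩
  exact div_le_div₀ ((norm_nonneg _).trans h3) h3 (sub_pos.2 hy) h1

theorem eventually_indicator_eq {D : Set ℂ} (hD : IsOpen D) {y : ℂ} (hy : y ∉ frontier D) :
    ∀ᶠ z in 𝓝 y, D.indicator (1 : ℂ → ℝ) z = D.indicator 1 y := by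
  by_cases hyD : y ∈ D
  · filter_upwards [hD.mem_nhds hyD] with z hz
    simp [hz, hyD]
  · have hcl : y ∉ closure D := fun h => hy ⟨h, by rwa [hD.interior_eq]⟩
    filter_upwards [isClosed_closure.isOpen_compl.mem_nhds hcl] with z hz
    have : z ∉ D := fun h => hz (subset_closure h)
    simp [this, hyD]

/-- The swept angle is constant on each side of the curve, and its value on the curve differs
from its value on the two sides by `π` and `-π`. -/
theorem exists_sweptAngle_eq_on_side (hc : IsRegularSimpleClosed c) {κ : ℝ}
    (hκ : κ = 1 ∨ κ = -1) :
    ∃ a, (∀ t δ, IsTube c t δ → ∀ p ∈ Metric.ball (t, (0:ℝ)) δ, 0 < κ * p.2 →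
      sweptAngle c (normalPush c p) = a) ∧ ∀ t, a - sweptAngle c (c t) = κ * π := by
  have hκ0 : κ ≠ 0 := by rcases hκ with rfl | rfl <;> norm_num
  have hκ2 : κ * κ = 1 := by rcases hκ with rfl | rfl <;> norm_num
  have hκa : |κ| = 1 := by rcases hκ with rfl | rfl <;> norm_num
  obtain ⟨a, ha⟩ := hc.exists_eq_on_side (fun y hy => hc.eventually_sweptAngle_eq hy) hκ0
  refine ⟨a, ha, fun t => ?_⟩
  obtain ⟨δ, hδ⟩ := hc.exists_isTube t
  have hδ0 := hδ.pos
  have hpos : ∀ x : ℝ, κ * (x * (κ * (δ / 2))) = x * (δ / 2) := fun x => by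
    rw [show κ * (x * (κ * (δ / 2))) = κ * κ * (x * (δ / 2)) by ring, hκ2, one_mul]
  have hmem : ∀ τ : ℝ, 0 < τ → τ ≤ 1 → (t, τ * (κ * (δ / 2))) ∈ Metric.ball (t, (0:ℝ)) δ := by
    intro τ h0 h1
    rw [← ball_prod_same]
    refine ⟨Metric.mem_ball_self hδ0, ?_⟩
    rw [mem_ball_zero_iff, Real.norm_eq_abs, abs_mul, abs_mul, hκa, one_mul,
      abs_of_pos h0, abs_of_pos (half_pos hδ0)]
    nlinarith
  have hκρ : 0 < κ * (κ * (δ / 2)) := by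
    have := hpos 1
    rw [one_mul, one_mul] at this
    rw [this]; positivity
  have hsub := hc.sweptAngle_sub (t := t) hκ hκρ fun τ h0 h1 hmemΓ => by
    have h2 : τ * (κ * (δ / 2)) = 0 := hδ.eq_zero _ (hmem τ h0 h1) hmemΓ
    have h3 := hpos τ
    rw [h2, mul_zero] at h3
    have : 0 < τ * (δ / 2) := by positivity
    exact this.ne h3
  have h4 := hmem 1 one_pos le_rfl
  rw [one_mul] at h4
  rw [← ha t δ hδ _ h4 hκρ, ← hsub]
  rfl

/-- A bounded open set whose boundary is the curve is the region around which the curve winds,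
in one of the two directions. -/
theorem exists_sweptAngle_eq_indicator (hc : IsRegularSimpleClosed c) {D : Set ℂ} (hD : IsOpen D)
    (hbdd : Bornology.IsBounded D) (hfr : frontier D = Set.range c) :
    ∃ ε : ℝ, (ε = 1 ∨ ε = -1) ∧
      (∀ y ∉ Set.range c, sweptAngle c y = ε * (2 * π) * D.indicator 1 y) ∧
      ∀ t, sweptAngle c (c t) = ε * π := by
  have hπ := Real.pi_pos
  set χ : ℂ → ℝ := D.indicator 1 with hχ
  have hχloc : ∀ y ∉ Set.range c, ∀ᶠ z in 𝓝 y, χ z = χ y := fun y hy =>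
    eventually_indicator_eq hD (hfr ▸ hy)
  have hχ01 : ∀ y, χ y = 0 ∨ χ y = 1 := fun y => by
    by_cases h : y ∈ D <;> simp [hχ, h]
  obtain ⟨aW, haW, haW'⟩ := hc.exists_sweptAngle_eq_on_side (Or.inl rfl)
  obtain ⟨bW, hbW, hbW'⟩ := hc.exists_sweptAngle_eq_on_side (Or.inr rfl)
  obtain ⟨aχ, haχ⟩ := hc.exists_eq_on_side hχloc (κ := 1) (by norm_num)
  obtain ⟨bχ, hbχ⟩ := hc.exists_eq_on_side hχloc (κ := -1) (by norm_num)
  have hside : ∀ κ : ℝ, |κ| = 1 → ∀ x, (∀ t δ, IsTube c t δ → ∀ p ∈ Metric.ball (t, (0:ℝ)) δ,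
      0 < κ * p.2 → χ (normalPush c p) = x) → x = 0 ∨ x = 1 := by
    intro κ hκ x hx
    obtain ⟨δ, hδ⟩ := hc.exists_isTube 0
    have hδ0 := hδ.pos
    have hκ2 : κ * κ = 1 := by rw [← abs_mul_abs_self, hκ, one_mul]
    rw [← hx 0 δ hδ (0, κ * (δ / 2)) ?_ ?_]
    · exact hχ01 _
    · rw [← ball_prod_same]
      refine ⟨Metric.mem_ball_self hδ0, ?_⟩
      rw [mem_ball_zero_iff, Real.norm_eq_abs, abs_mul, hκ, one_mul, abs_of_pos (half_pos hδ0)]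
      linarith
    · rw [← mul_assoc, hκ2]
      positivity
  have ha01 := hside 1 (by simp) aχ haχ
  have hb01 := hside (-1) (by simp) bχ hbχ
  set k := (aχ - bχ) / (2 * π) with hk
  have hab : aW - bW = 2 * π := by linarith [haW' 0, hbW' 0]
  have hkab : k * (aW - bW) = aχ - bχ := by rw [hab, hk]; field_simp
  classical
  set g : ℂ → ℝ := fun y => if y ∈ Set.range c then aχ - k * aW else χ y - k * sweptAngle c y
    with hg
  have hgloc : IsLocallyConstant g := (IsLocallyConstant.iff_eventually_eq _).2 fun y => by
    by_cases hy : y ∈ Set.range c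
    · obtain ⟨t, rfl⟩ := hy
      obtain ⟨δ, hδ⟩ := hc.exists_isTube t
      have hmem : c t ∈ normalPush c '' Metric.ball (t, 0) δ :=
        ⟨(t, 0), Metric.mem_ball_self hδ.pos, by simp [normalPush]⟩
      filter_upwards [hδ.isOpen.mem_nhds hmem]
      rintro _ ⟨p, hp, rfl⟩
      have hgt : g (c t) = aχ - k * aW := if_pos ⟨t, rfl⟩
      rw [hgt]
      by_cases hpΓ : normalPush c p ∈ Set.range c
      · exact if_pos hpΓ
      · have hgp : g (normalPush c p) = χ (normalPush c p) - k * sweptAngle c (normalPush c p) :=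
          if_neg hpΓ
        rw [hgp]
        have hp2 : p.2 ≠ 0 := fun h => hpΓ ⟨p.1, by simp [normalPush, h]⟩
        rcases hp2.lt_or_gt with h | h
        · rw [hbχ t δ hδ p hp (by linarith), hbW t δ hδ p hp (by linarith)]
          linarith
        · rw [haχ t δ hδ p hp (by linarith), haW t δ hδ p hp (by linarith)]
    · filter_upwards [hc.isCompact_range.isClosed.isOpen_compl.mem_nhds hy, hχloc y hy,
        hc.eventually_sweptAngle_eq hy] with z hz h1 h2
      have hz' : z ∉ Set.range c := hz
      simp only [hg, if_neg hz', if_neg hy, h1, h2]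
  have hgconst : ∀ y z, g y = g z := fun y z =>
    hgloc.apply_eq_of_isPreconnected isPreconnected_univ trivial trivial
  have hg0 : ∀ y, g y = 0 := by
    intro y
    have hlim : Tendsto g (cocompact ℂ) (𝓝 0) := by
      have h1 := (hc.tendsto_sweptAngle_cocompact.const_mul k).neg
      rw [mul_zero, neg_zero] at h1
      refine h1.congr' ?_
      filter_upwards [hc.isCompact_range.compl_mem_cocompact,
        hbdd.isCompact_closure.compl_mem_cocompact] with z hz hzD
      have hz' : z ∉ Set.range c := hz
      have hzD' : z ∉ D := fun h => hzD (subset_closure h)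
      have hgz : g z = χ z - k * sweptAngle c z := if_neg hz'
      simp [hgz, hχ, hzD']
    refine tendsto_nhds_unique ?_ hlim
    exact tendsto_const_nhds.congr fun z => hgconst y z
  have hoff : ∀ y ∉ Set.range c, χ y = k * sweptAngle c y := fun y hy => by
    have := hg0 y
    simp only [hg, if_neg hy] at this
    linarith
  have haχW : aχ = k * aW := by
    have h1 : g (c 0) = aχ - k * aW := if_pos ⟨0, rfl⟩
    linarith [hg0 (c 0)]
  have hk0 : k ≠ 0 := by
    intro h
    have hne : D.Nonempty := by
      rw [Set.nonempty_iff_ne_empty]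
      rintro rfl
      rw [frontier_empty] at hfr
      exact (Set.range_nonempty c).ne_empty hfr.symm
    obtain ⟨y, hy⟩ := hne
    have hyΓ : y ∉ Set.range c := fun hy' => by
      have : y ∈ D ∩ frontier D := ⟨hy, hfr ▸ hy'⟩
      rw [hD.inter_frontier_eq] at this
      exact this
    have := hoff y hyΓ
    rw [h, zero_mul] at this
    simp [hχ, hy] at this
  have hk2 : k * (2 * π) = aχ - bχ := by rw [hk]; field_simp
  have hcases : (aχ = 1 ∧ bχ = 0) ∨ (aχ = 0 ∧ bχ = 1) := by
    rcases ha01 with ha | ha <;> rcases hb01 with hb | hb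
    · exact absurd (by simp [hk, ha, hb]) hk0
    · exact Or.inr ⟨ha, hb⟩
    · exact Or.inl ⟨ha, hb⟩
    · exact absurd (by simp [hk, ha, hb]) hk0
  have hεε : (aχ - bχ) * (aχ - bχ) = 1 := by
    rcases hcases with ⟨ha, hb⟩ | ⟨ha, hb⟩ <;> rw [ha, hb] <;> norm_num
  refine ⟨aχ - bχ, ?_, fun y hy => ?_, fun t => ?_⟩
  · rcases hcases with ⟨ha, hb⟩ | ⟨ha, hb⟩ <;> rw [ha, hb] <;> norm_num
  · rw [hoff y hy, show (aχ - bχ) * (2 * π) * (k * sweptAngle c y)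
      = (aχ - bχ) * (k * (2 * π)) * sweptAngle c y by ring, hk2, hεε, one_mul]
  · have haW1 : aW = (aχ - bχ) * (2 * π) * aχ := by
      rw [haχW, show (k * aW - bχ) * (2 * π) * (k * aW)
        = (k * aW - bχ) * (k * (2 * π)) * aW by ring, hk2, ← haχW, hεε, one_mul]
    have := haW' t
    rcases hcases with ⟨ha, hb⟩ | ⟨ha, hb⟩ <;> rw [ha, hb] at haW1 ⊢ <;> linarith

end IsRegularSimpleClosed

theorem circleAverage_inv_sub_of_lt {z : ℂ} {r : ℝ} (hr : 0 ≤ r) (h : r < ‖z‖) :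
    circleAverage (fun y => (z - y)⁻¹) 0 r = z⁻¹ := by
  have hd : DiffContOnCl ℂ (fun y => (z - y)⁻¹) (Metric.ball 0 |r|) := by
    refine DifferentiableOn.diffContOnCl fun y hy => ?_
    have hy' := Metric.closure_ball_subset_closedBall hy
    rw [mem_closedBall_zero_iff, abs_of_nonneg hr] at hy'
    refine (((differentiableAt_const z).sub differentiableAt_id).inv ?_).differentiableWithinAt
    intro h0
    have h1 : z = y := sub_eq_zero.1 h0
    exact absurd (h1 ▸ h) (not_lt.2 hy')
  simpa using hd.circleAverage

theorem circleAverage_inv_sub_of_gt {z : ℂ} {r : ℝ} (hz : z ≠ 0) (h : ‖z‖ < r) :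
    circleAverage (fun y => (z - y)⁻¹) 0 r = 0 := by
  have hr : 0 < r := (norm_nonneg z).trans_lt h
  have h1 := (diffContOnCl_const (c := (1:ℂ)) (s := Metric.ball (0:ℂ) |r|)).circleAverage_smul_div
    (w := z) (by simpa [abs_of_pos hr] using h)
  have hne : ∀ y ∈ Metric.sphere (0:ℂ) |r|, y - z ≠ 0 := fun y hy h0 => by
    rw [mem_sphere_zero_iff_norm, sub_eq_zero.1 h0, abs_of_pos hr] at hy
    exact h.ne hy
  have hci : CircleIntegrable (fun y => (z - y)⁻¹) 0 r := by
    refine ContinuousOn.circleIntegrable' ?_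
    refine ContinuousOn.inv₀ (by fun_prop) fun y hy h0 => hne y hy ?_
    rw [← neg_sub, h0, neg_zero]
  have h2 : circleAverage (fun y => ((y - 0) / (y - z)) • (1:ℂ)) 0 r
      = circleAverage (fun y => (1:ℂ) - z * (z - y)⁻¹) 0 r := by
    refine circleAverage_congr_sphere fun y hy => ?_
    have hy' := hne y hy
    have : z - y ≠ 0 := fun h0 => hy' (by rw [← neg_sub, h0, neg_zero])
    simp only [sub_zero, smul_eq_mul, mul_one]
    field_simp
    ring
  rw [h2] at h1
  have h3 : circleAverage (fun y => (1:ℂ) - z * (z - y)⁻¹) 0 r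
      = 1 - z * circleAverage (fun y => (z - y)⁻¹) 0 r := by
    have := circleAverage_sub (f₁ := fun _ => (1:ℂ)) (f₂ := fun y => z * (z - y)⁻¹) (c := 0) (R := r)
      (circleIntegrable_const _ _ _) (hci.const_smul (a := z))
    have h4 := circleAverage_smul (a := z) (f := fun y => (z - y)⁻¹) (c := 0) (R := r)
    rw [circleAverage_const] at this
    exact this.trans (congrArg _ h4)
  rw [h3] at h1
  have : z * circleAverage (fun y => (z - y)⁻¹) 0 r = 0 := by linear_combination -h1
  exact (mul_eq_zero.1 this).resolve_left hz

theorem integrable_indicator_ball_inv_norm (R : ℝ) :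
    Integrable (fun y : ℂ => (Metric.ball (0:ℂ) R).indicator (fun y => ‖y‖⁻¹) y) := by
  have h := (integrable_fun_norm_addHaar (volume : Measure ℂ)
    (f := fun r => (Set.Iio R).indicator (fun r => r⁻¹) r)).2 ?_
  · refine h.congr (Eventually.of_forall fun y => ?_)
    simp [Set.indicator]
  · rw [Complex.finrank_real_complex]
    have : IntegrableOn (fun r : ℝ => (Set.Iio R).indicator (fun _ => (1:ℝ)) r) (Set.Ioi 0) := by
      rw [IntegrableOn, integrable_indicator_iff measurableSet_Iio, IntegrableOn,
        Measure.restrict_restrict measurableSet_Iio]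
      have : IntegrableOn (fun _ : ℝ => (1:ℝ)) (Set.Icc 0 R) := continuous_const.integrableOn_Icc
      exact this.mono_set fun x hx => ⟨le_of_lt hx.2, le_of_lt hx.1⟩
    refine this.congr_fun (fun r hr => ?_) measurableSet_Ioi
    have : r ≠ 0 := ne_of_gt hr
    by_cases hrR : r < R <;> simp [hrR, this]

theorem integrableOn_inv_norm_sub {z : ℂ} {R : ℝ} (hz : ‖z‖ < R) :
    IntegrableOn (fun y : ℂ => ‖z - y‖⁻¹) (Metric.ball 0 R) ∧
    ∫ y in Metric.ball 0 R, ‖z - y‖⁻¹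
      ≤ ∫ y : ℂ, (Metric.ball (0:ℂ) (2 * R)).indicator (fun y => ‖y‖⁻¹) y := by
  have h := (integrable_indicator_ball_inv_norm (2 * R)).comp_sub_left z
  have hle : ∀ y ∈ Metric.ball (0:ℂ) R, ‖z - y‖⁻¹
      = (Metric.ball (0:ℂ) (2 * R)).indicator (fun y => ‖y‖⁻¹) (z - y) := fun y hy => by
    rw [Set.indicator_of_mem]
    rw [mem_ball_zero_iff] at hy ⊢
    linarith [norm_sub_le z y]
  refine ⟨h.integrableOn.congr_fun (fun y hy => (hle y hy).symm) measurableSet_ball, ?_⟩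
  rw [setIntegral_congr_fun measurableSet_ball hle]
  refine (setIntegral_le_integral h (Eventually.of_forall fun y =>
    Set.indicator_nonneg (fun _ _ => by positivity) _)).trans_eq ?_
  exact integral_sub_left_eq_self
    (fun y => (Metric.ball (0:ℂ) (2 * R)).indicator (fun y => ‖y‖⁻¹) y) volume z

theorem setIntegral_ball_inv_sub {z : ℂ} {R : ℝ} (hz : ‖z‖ < R) :
    ∫ y in Metric.ball 0 R, (z - y)⁻¹ = π * (starRingEnd ℂ) z := by
  have hR : 0 < R := (norm_nonneg z).trans_lt hz
  rcases eq_or_ne z 0 with rfl | hz0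
  · have : ∫ y in Metric.ball (0:ℂ) R, ((0:ℂ) - y)⁻¹ = - ∫ y in Metric.ball (0:ℂ) R, ((0:ℂ) - y)⁻¹ := by
      rw [← integral_indicator measurableSet_ball, ← integral_neg,
        ← integral_neg_eq_self]
      congr 1
      ext y
      by_cases hy : ‖y‖ < R <;> simp [Set.indicator, hy]
    have h0 : ∫ y in Metric.ball (0:ℂ) R, ((0:ℂ) - y)⁻¹ = 0 := by
      exact self_eq_neg.1 this
    rw [h0]; simp
  set f : ℂ → ℂ := (Metric.ball 0 R).indicator (fun y => (z - y)⁻¹) with hf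
  have hfm : Measurable f := by
    refine Measurable.indicator ?_ measurableSet_ball
    fun_prop
  have hfi : Integrable f := by
    rw [hf, integrable_indicator_iff measurableSet_ball]
    refine (integrableOn_inv_norm_sub hz).1.mono' (by fun_prop) ?_
    exact Eventually.of_forall fun y => by rw [norm_inv]
  set g : ℝ × ℝ → ℂ := fun p => p.1 • f (Complex.polarCoord.symm p) with hg
  have hsm : Measurable fun p : ℝ × ℝ => Complex.polarCoord.symm p := by
    simp only [Complex.polarCoord_symm_apply]
    fun_prop
  have hgi : IntegrableOn g polarCoord.target := by
    refine ⟨(measurable_fst.smul (hfm.comp hsm)).aestronglyMeasurable, ?_⟩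
    have h := Complex.lintegral_comp_polarCoord_symm (fun y => ‖f y‖ₑ)
    rw [HasFiniteIntegral]
    refine lt_of_le_of_lt (le_of_eq ?_) hfi.2
    rw [← h]
    refine setLIntegral_congr_fun polarCoord.open_target.measurableSet fun p hp => ?_
    simp only [hg, enorm_smul, smul_eq_mul]
    rw [Real.enorm_of_nonneg (le_of_lt hp.1)]
  have hinner : ∀ r ∈ Set.Ioi (0:ℝ), r ≠ ‖z‖ →
      ∫ θ in Set.Ioo (-π) π, g (r, θ) = (Set.Ioo 0 ‖z‖).indicator (fun r : ℝ => 2 * π * z⁻¹ * r) r := by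
    intro r hr hrz
    have hr : 0 < r := hr
    have h1 : ∀ θ : ℝ, g (r, θ) = r • f (circleMap 0 r θ) := fun θ => by
      simp [hg, circleMap, Complex.exp_mul_I]
    have hcirc : ∀ θ, ‖circleMap 0 r θ‖ = r := fun θ => by simp [abs_of_pos hr]
    simp only [h1]
    rw [integral_smul, ← integral_Ioc_eq_integral_Ioo,
      ← intervalIntegral.integral_of_le (by linarith [pi_pos])]
    have hper : Function.Periodic (fun θ => f (circleMap 0 r θ)) (2 * π) := fun θ => by
      simp only [periodic_circleMap 0 r θ]
    have h2 := hper.intervalIntegral_add_eq (-π) 0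
    rw [show -π + 2 * π = π by ring, zero_add] at h2
    rw [h2]
    by_cases hrR : r < R
    · have h3 : ∀ θ, f (circleMap 0 r θ) = (fun y => (z - y)⁻¹) (circleMap 0 r θ) := fun θ => by
        rw [hf, Set.indicator_of_mem]
        rw [mem_ball_zero_iff, hcirc]; exact hrR
      simp only [h3]
      have h4 : ∫ θ in (0:ℝ)..(2 * π), (fun y => (z - y)⁻¹) (circleMap 0 r θ)
          = (2 * π) • circleAverage (fun y => (z - y)⁻¹) 0 r := by
        rw [circleAverage_def, smul_smul, mul_inv_cancel₀ (by positivity), one_smul]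
      rw [h4]
      rcases lt_or_gt_of_ne hrz with hlt | hgt
      · rw [circleAverage_inv_sub_of_lt hr.le hlt, Set.indicator_of_mem (s := Set.Ioo 0 ‖z‖) ⟨hr, hlt⟩]
        simp; ring
      · rw [circleAverage_inv_sub_of_gt hz0 hgt, Set.indicator_of_notMem fun h => hgt.not_gt h.2]
        simp
    · have h3 : ∀ θ, f (circleMap 0 r θ) = 0 := fun θ => by
        rw [hf, Set.indicator_of_notMem]
        rw [mem_ball_zero_iff, hcirc]; exact hrR
      rw [Set.indicator_of_notMem fun h => hrR (h.2.trans hz)]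
      simp [h3]
  rw [← integral_indicator measurableSet_ball, ← Complex.integral_comp_polarCoord_symm]
  have h5 : ∫ p in polarCoord.target, g p
      = ∫ r in Set.Ioi (0:ℝ), ∫ θ in Set.Ioo (-π) π, g (r, θ) := by
    exact setIntegral_prod g hgi
  refine h5.trans ?_
  have h6 : ∫ r in Set.Ioi (0:ℝ), ∫ θ in Set.Ioo (-π) π, g (r, θ)
      = ∫ r in Set.Ioi (0:ℝ), (Set.Ioo 0 ‖z‖).indicator (fun r : ℝ => 2 * π * z⁻¹ * r) r := by
    refine setIntegral_congr_ae measurableSet_Ioi ?_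
    filter_upwards [Measure.ae_ne volume ‖z‖] with r hr hr0
    exact hinner r hr0 hr
  rw [h6, setIntegral_indicator measurableSet_Ioo,
    Set.inter_eq_right.2 fun x hx => hx.1, ← integral_Ioc_eq_integral_Ioo,
    ← intervalIntegral.integral_of_le (norm_nonneg z), intervalIntegral.integral_const_mul,
    intervalIntegral.integral_ofReal, integral_id]
  have h7 : z * (starRingEnd ℂ) z = ((‖z‖ ^ 2 : ℝ) : ℂ) := by
    rw [Complex.mul_conj, Complex.normSq_eq_norm_sq]
  push_cast at h7 ⊢
  field_simp
  rw [h7]; ring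

namespace IsRegularSimpleClosed

variable {c : ℝ → ℂ}

theorem integrable_angularVelocity_prod (hc : IsRegularSimpleClosed c) {R : ℝ}
    (hR : ∀ s, ‖c s‖ < R) :
    Integrable (fun p : ℝ × ℂ => angularVelocity c p.2 p.1)
      ((volume.restrict (Set.Ioc 0 (2 * π))).prod (volume.restrict (Metric.ball 0 R))) := by
  have hm : Measurable (fun p : ℝ × ℂ => angularVelocity c p.2 p.1) :=
    hc.measurable_angularVelocity.comp measurable_swap
  obtain ⟨M, hM⟩ := isCompact_Icc.exists_bound_of_continuousOn
    (hc.continuous_deriv.continuousOn (s := Set.Icc 0 (2 * π)))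
  have hle : ∀ s ∈ Set.Icc 0 (2 * π), ∀ y, ‖angularVelocity c y s‖ ≤ M * ‖c s - y‖⁻¹ :=
    fun s hs y => by
      refine (Complex.abs_im_le_norm _).trans ?_
      rw [norm_div, div_eq_mul_inv]
      gcongr
      exact hM s hs
  have hint := fun s => integrableOn_inv_norm_sub (hR s)
  have hM0 : 0 ≤ M := (norm_nonneg _).trans (hM 0 ⟨le_rfl, by positivity⟩)
  have hy : ∀ s ∈ Set.Icc 0 (2 * π),
      IntegrableOn (fun y => angularVelocity c y s) (Metric.ball 0 R) := fun s hs =>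
    ((hint s).1.const_mul M).mono' (hm.comp measurable_prodMk_left).aestronglyMeasurable
      (Eventually.of_forall (hle s hs))
  refine (integrable_prod_iff hm.aestronglyMeasurable).2 ⟨?_, ?_⟩
  · refine (ae_restrict_iff' measurableSet_Ioc).2 (Eventually.of_forall fun s hs => ?_)
    exact hy s (Set.Ioc_subset_Icc_self hs)
  · refine Integrable.mono' (g := fun _ => M * ∫ y : ℂ,
      (Metric.ball (0:ℂ) (2 * R)).indicator (fun y => ‖y‖⁻¹) y) ?_ ?_ ?_
    · exact continuous_const.integrableOn_Ioc
    · exact hm.aestronglyMeasurable.norm.integral_prod_right'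
    · refine (ae_restrict_iff' measurableSet_Ioc).2 (Eventually.of_forall fun s hs => ?_)
      have hs := Set.Ioc_subset_Icc_self hs
      rw [Real.norm_of_nonneg (integral_nonneg fun y => norm_nonneg _)]
      refine (integral_mono (hy s hs).norm ((hint s).1.const_mul M) (hle s hs)).trans ?_
      rw [integral_const_mul]
      exact mul_le_mul_of_nonneg_left (hint s).2 hM0

/-- The integral of the swept angle over a disc containing the curve is `2π` times the signed area
enclosed by the curve. -/
theorem setIntegral_sweptAngle (hc : IsRegularSimpleClosed c) {R : ℝ} (hR : ∀ s, ‖c s‖ < R) :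
    ∫ y in Metric.ball 0 R, sweptAngle c y
      = π * ∫ s in (0:ℝ)..(2 * π), ((starRingEnd ℂ) (c s) * deriv c s).im := by
  have hp : (0:ℝ) ≤ 2 * π := by positivity
  simp only [sweptAngle, intervalIntegral.integral_of_le hp]
  rw [integral_integral_swap (f := fun y s => angularVelocity c y s)
    (hc.integrable_angularVelocity_prod hR).swap, ← integral_const_mul]
  refine integral_congr_ae (Eventually.of_forall fun s => ?_)
  have hi : IntegrableOn (fun y => (c s - y)⁻¹) (Metric.ball 0 R) :=
    (integrableOn_inv_norm_sub (hR s)).1.mono' (by fun_prop)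
      (Eventually.of_forall fun y => by rw [norm_inv])
  have h := integral_im (hi.const_mul (deriv c s))
  simp only [RCLike.im_to_complex] at h
  simp only [angularVelocity, div_eq_mul_inv]
  rw [h, integral_const_mul, setIntegral_ball_inv_sub (hR s)]
  rw [show deriv c s * (π * (starRingEnd ℂ) (c s)) = (π : ℂ) * ((starRingEnd ℂ) (c s) * deriv c s)
    by ring, Complex.im_ofReal_mul]

theorem sweptAngle_eq_of_area_pos (hc : IsRegularSimpleClosed c) {D : Set ℂ} (hD : IsOpen D)
    (hbdd : Bornology.IsBounded D) (hfr : frontier D = Set.range c)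
    (harea : 0 < ∫ s in (0:ℝ)..(2 * π), ((starRingEnd ℂ) (c s) * deriv c s).im) :
    (∀ y ∉ closure D, sweptAngle c y = 0) ∧ ∀ t, sweptAngle c (c t) = π := by
  obtain ⟨ε, hε, h1, h2⟩ := hc.exists_sweptAngle_eq_indicator hD hbdd hfr
  obtain ⟨R, hR⟩ := hc.isCompact_range.isBounded.subset_ball 0
  have hR' : ∀ s, ‖c s‖ < R := fun s => mem_ball_zero_iff.1 (hR ⟨s, rfl⟩)
  have hε1 : ε = 1 := by
    refine hε.resolve_right ?_
    rintro rfl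
    have hle : ∫ y in Metric.ball 0 R, sweptAngle c y ≤ 0 := by
      refine integral_nonpos fun y => ?_
      by_cases hy : y ∈ Set.range c
      · obtain ⟨t, rfl⟩ := hy
        rw [h2]
        simp [pi_pos.le]
      · rw [h1 y hy]
        have : 0 ≤ D.indicator (1 : ℂ → ℝ) y := Set.indicator_nonneg (by simp) y
        have := mul_nonneg two_pi_pos.le this
        simp only [Pi.zero_apply]
        linarith
    rw [hc.setIntegral_sweptAngle hR'] at hle
    exact absurd (mul_pos pi_pos harea) (not_lt.2 hle)
  subst hε1
  refine ⟨fun y hy => ?_, fun t => by rw [h2, one_mul]⟩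
  have hy1 : y ∉ Set.range c := fun h => hy (frontier_subset_closure (hfr ▸ h))
  rw [h1 y hy1, Set.indicator_of_notMem fun h => hy (subset_closure h), mul_zero]

end IsRegularSimpleClosed

namespace IsRegularSimpleClosed

variable {c : ℝ → ℂ}

theorem integral_integral_angularVelocity_mul (hc : IsRegularSimpleClosed c) {d : ℝ → ℂ}
    (hd : Continuous d) {f : ℝ → ℝ} (hf : Continuous f)
    (hb : ∃ C, ∀ s ∈ Set.Icc 0 (2 * π), ∀ t ∈ Set.Icc 0 (2 * π),
      |angularVelocity c (d t) s| ≤ C) :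
    IntervalIntegrable (fun s => ∫ t in (0:ℝ)..(2 * π), angularVelocity c (d t) s * f t)
      volume 0 (2 * π) ∧
    ∫ s in (0:ℝ)..(2 * π), ∫ t in (0:ℝ)..(2 * π), angularVelocity c (d t) s * f t
      = ∫ t in (0:ℝ)..(2 * π), sweptAngle c (d t) * f t := by
  have hp : (0:ℝ) ≤ 2 * π := by positivity
  obtain ⟨C, hC⟩ := hb
  have hm : Measurable fun p : ℝ × ℝ => angularVelocity c (d p.2) p.1 :=
    hc.measurable_angularVelocity.comp
      ((hd.measurable.comp measurable_snd).prodMk measurable_fst)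
  have hint : Integrable (fun p : ℝ × ℝ => angularVelocity c (d p.2) p.1 * f p.2)
      ((volume.restrict (Set.Ioc 0 (2 * π))).prod (volume.restrict (Set.Ioc 0 (2 * π)))) := by
    have hfi : Integrable f (volume.restrict (Set.Ioc 0 (2 * π))) := hf.integrableOn_Ioc
    have h1 : Integrable (fun _ : ℝ => (1:ℝ)) (volume.restrict (Set.Ioc 0 (2 * π))) :=
      continuous_const.integrableOn_Ioc
    have h2 := (h1.mul_prod hfi)
    simp only [one_mul] at h2
    refine h2.bdd_mul (c := C) hm.aestronglyMeasurable ?_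
    rw [Measure.prod_restrict]
    refine (ae_restrict_iff' (measurableSet_Ioc.prod measurableSet_Ioc)).2
      (Eventually.of_forall fun p hp => ?_)
    exact hC _ (Set.Ioc_subset_Icc_self hp.1) _ (Set.Ioc_subset_Icc_self hp.2)
  simp only [intervalIntegral.integral_of_le hp, intervalIntegrable_iff_integrableOn_Ioc_of_le hp]
  refine ⟨hint.integral_prod_left, ?_⟩
  rw [integral_integral_swap hint]
  refine integral_congr_ae (Eventually.of_forall fun t => ?_)
  simp only [sweptAngle, intervalIntegral.integral_of_le hp, integral_mul_const]

end IsRegularSimpleClosed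

/-- The identification of the Euclidean plane with the complex plane. -/
def planeToComplex : E2 ≃ₗᵢ[ℝ] ℂ := Complex.orthonormalBasisOneI.repr.symm

theorem planeToComplex_re (v : E2) : (planeToComplex v).re = v 0 := by
  obtain ⟨z, rfl⟩ := planeToComplex.symm.surjective v
  simp [planeToComplex]

theorem planeToComplex_im (v : E2) : (planeToComplex v).im = v 1 := by
  obtain ⟨z, rfl⟩ := planeToComplex.symm.surjective v
  simp [planeToComplex]

theorem deriv_planeToComplex_comp {γ : ℝ → E2} {s : ℝ} (h : DifferentiableAt ℝ γ s) :
    deriv (planeToComplex ∘ γ) s = planeToComplex (deriv γ s) :=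
  (planeToComplex.toContinuousLinearEquiv.toContinuousLinearMap.hasFDerivAt.comp_hasDerivAt s
    h.hasDerivAt).deriv

theorem Kker_mul_norm_deriv {N : ℕ} {γ : Fin N → ℝ → E2} (i j : Fin N) (s t : ℝ)
    (h : DifferentiableAt ℝ (γ i) s) (h0 : deriv (γ i) s ≠ 0) :
    Kker γ i j s t * ‖deriv (γ i) s‖
      = -(1 / (2 * π)) * (angularVelocity (planeToComplex ∘ γ i) (planeToComplex (γ j t)) s
        * ‖deriv (γ j) t‖) := by
  have hn : ‖deriv (γ i) s‖ ≠ 0 := norm_ne_zero_iff.2 h0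
  have key : angularVelocity (planeToComplex ∘ γ i) (planeToComplex (γ j t)) s
      = ((γ i s - γ j t) 0 * deriv (γ i) s 1 - (γ i s - γ j t) 1 * deriv (γ i) s 0)
        / ‖γ i s - γ j t‖ ^ 2 := by
    rw [angularVelocity, deriv_planeToComplex_comp h, Function.comp_apply, ← map_sub,
      Complex.div_im, Complex.normSq_eq_norm_sq, LinearIsometryEquiv.norm_map,
      planeToComplex_re, planeToComplex_im, planeToComplex_re, planeToComplex_im]
    ring
  rw [key, Kker]
  rcases eq_or_ne ‖γ i s - γ j t‖ 0 with hz | hz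
  · simp [hz]
  · field_simp

theorem isRegularSimpleClosed_planeToComplex_comp {γ : ℝ → E2} (hγ : ContDiff ℝ 2 γ)
    (hper : ∀ t, γ (t + 2 * π) = γ t) (hreg : ∀ t, deriv γ t ≠ 0)
    (hinj : Set.InjOn γ (Set.Ico 0 (2 * π))) : IsRegularSimpleClosed (planeToComplex ∘ γ) where
  contDiff := planeToComplex.contDiff.comp hγ
  periodic t := congrArg planeToComplex (hper t)
  deriv_ne_zero t := by
    rw [deriv_planeToComplex_comp (hγ.differentiable (by norm_num) t)]
    exact planeToComplex.map_eq_zero_iff.not.2 (hreg t)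
  injOn := planeToComplex.injective.comp_injOn hinj

/-- The Gauss identities for the boundary of a positively oriented bounded planar region. -/
theorem sweptAngle_planeToComplex_comp {D : Set E2} (hopen : IsOpen D)
    (hbdd : Bornology.IsBounded D) {γ : ℝ → E2} (hγ : ContDiff ℝ 2 γ)
    (hper : ∀ t, γ (t + 2 * π) = γ t) (hreg : ∀ t, deriv γ t ≠ 0)
    (hinj : Set.InjOn γ (Set.Ico 0 (2 * π))) (hfront : frontier D = Set.range γ)
    (horient : (1/2) * ∫ t in (0:ℝ)..(2 * π), (γ t 0 * deriv γ t 1 - γ t 1 * deriv γ t 0)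
      = (volume D).toReal) :
    (∀ y ∉ closure D, sweptAngle (planeToComplex ∘ γ) (planeToComplex y) = 0) ∧
      ∀ t, sweptAngle (planeToComplex ∘ γ) (planeToComplex (γ t)) = π := by
  have hc := isRegularSimpleClosed_planeToComplex_comp hγ hper hreg hinj
  have hne : D.Nonempty := by
    rw [Set.nonempty_iff_ne_empty]
    rintro rfl
    rw [frontier_empty] at hfront
    exact (Set.range_nonempty γ).ne_empty hfront.symm
  have hvol : 0 < (volume D).toReal :=
    ENNReal.toReal_pos (hopen.measure_pos volume hne).ne' hbdd.measure_lt_top.ne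
  have hfr : frontier (planeToComplex '' D) = Set.range (planeToComplex ∘ γ) := by
    rw [Set.range_comp, ← hfront]
    exact (planeToComplex.toHomeomorph.image_frontier D).symm
  have hcl : closure (planeToComplex '' D) = planeToComplex '' closure D :=
    (planeToComplex.toHomeomorph.image_closure D).symm
  have harea : 0 < ∫ s in (0:ℝ)..(2 * π), ((starRingEnd ℂ) ((planeToComplex ∘ γ) s)
      * deriv (planeToComplex ∘ γ) s).im := by
    have : ∀ s, ((starRingEnd ℂ) ((planeToComplex ∘ γ) s) * deriv (planeToComplex ∘ γ) s).im
        = γ s 0 * deriv γ s 1 - γ s 1 * deriv γ s 0 := fun s => by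
      rw [deriv_planeToComplex_comp (hγ.differentiable (by norm_num) s), Function.comp_apply,
        Complex.mul_im, Complex.conj_re, Complex.conj_im, planeToComplex_re, planeToComplex_im,
        planeToComplex_re, planeToComplex_im]
      ring
    simp only [this]
    linarith
  obtain ⟨h1, h2⟩ := hc.sweptAngle_eq_of_area_pos
    (planeToComplex.toHomeomorph.isOpenMap D hopen)
    (planeToComplex.lipschitz.isBounded_image hbdd) hfr harea
  refine ⟨fun y hy => h1 _ fun h => ?_, h2⟩
  obtain ⟨x, hx, hxy⟩ := hcl.subset h
  exact hy (planeToComplex.injective hxy ▸ hx)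

theorem exists_abs_angularVelocity_le_of_disjoint {c d : ℝ → ℂ} (hc : IsRegularSimpleClosed c)
    (hd : Continuous d) (h : ∀ s t, c s ≠ d t) (a b : ℝ) :
    ∃ C, ∀ s ∈ Set.Icc a b, ∀ t ∈ Set.Icc a b, |angularVelocity c (d t) s| ≤ C := by
  have hcont : Continuous fun p : ℝ × ℝ => angularVelocity c (d p.2) p.1 :=
    Complex.continuous_im.comp ((hc.continuous_deriv.comp continuous_fst).div
      ((hc.continuous.comp continuous_fst).sub (hd.comp continuous_snd))
      fun p => sub_ne_zero.2 (h p.1 p.2))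
  obtain ⟨C, hC⟩ := ((isCompact_Icc (a := a) (b := b)).prod
    (isCompact_Icc (a := a) (b := b))).exists_bound_of_continuousOn hcont.continuousOn
  exact ⟨C, fun s hs t ht => hC (s, t) ⟨hs, ht⟩⟩

/-- If `μ` solves the augmented equation `(½I + K + L)μ = -(½I + K)σ`, where `L` is
the block diagonal operator `L i μ i (x) = ∫_{Γ i} μ i ds`, then `∫_{Γ i} μ i ds = 0`
for every `i` and `μ` solves `(½I + K)μ = -(½I + K)σ`. -/
theorem augmented_equation_equivalence
    (N : ℕ) (D : Fin N → Set E2)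
    (hopen : ∀ j, IsOpen (D j)) (hbdd : ∀ j, Bornology.IsBounded (D j))
    (hdisj : Pairwise fun i j => Disjoint (closure (D i)) (closure (D j)))
    (γ : Fin N → ℝ → E2)
    (hγ : ∀ j, ContDiff ℝ 2 (γ j))
    (hper : ∀ j t, γ j (t + 2*π) = γ j t)
    (hreg : ∀ j t, deriv (γ j) t ≠ 0)
    (hinj : ∀ j, Set.InjOn (γ j) (Set.Ico 0 (2*π)))
    (hfront : ∀ j, frontier (D j) = Set.range (γ j))
    (horient : ∀ j, (1/2) * ∫ t in (0:ℝ)..(2*π),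
        (γ j t 0 * deriv (γ j) t 1 - γ j t 1 * deriv (γ j) t 0) = (volume (D j)).toReal)
    (μ σ : Fin N → ℝ → ℝ)
    (hμc : ∀ j, Continuous (μ j)) (hσc : ∀ j, Continuous (σ j))
    (hμper : ∀ j t, μ j (t + 2*π) = μ j t) (hσper : ∀ j t, σ j (t + 2*π) = σ j t)
    (heq : ∀ i s, (1/2) * μ i s
        + (∑ j, ∫ t in (0:ℝ)..(2*π), Kker γ i j s t * μ j t)
        + (∫ t in (0:ℝ)..(2*π), μ i t * ‖deriv (γ i) t‖)
        = -((1/2) * σ i s + ∑ j, ∫ t in (0:ℝ)..(2*π), Kker γ i j s t * σ j t)) :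
    (∀ i, ∫ t in (0:ℝ)..(2*π), μ i t * ‖deriv (γ i) t‖ = 0) ∧
    (∀ i s, (1/2) * μ i s + (∑ j, ∫ t in (0:ℝ)..(2*π), Kker γ i j s t * μ j t)
        = -((1/2) * σ i s + ∑ j, ∫ t in (0:ℝ)..(2*π), Kker γ i j s t * σ j t)) := by
  have hdiff : ∀ i s, DifferentiableAt ℝ (γ i) s := fun i s =>
    (hγ i).differentiable (by norm_num) s
  have hcurve := fun i =>
    isRegularSimpleClosed_planeToComplex_comp (hγ i) (hper i) (hreg i) (hinj i)
  have hspeed : ∀ i, Continuous fun s => ‖deriv (γ i) s‖ := fun i =>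
    ((hγ i).continuous_deriv (by norm_num)).norm
  have hgauss := fun i => sweptAngle_planeToComplex_comp (hopen i) (hbdd i) (hγ i) (hper i)
    (hreg i) (hinj i) (hfront i) (horient i)
  have hmem : ∀ i t, γ i t ∈ closure (D i) := fun i t =>
    frontier_subset_closure (hfront i ▸ Set.mem_range_self t)
  have hne : ∀ i j, i ≠ j → ∀ t, γ j t ∉ closure (D i) := fun i j hij t h =>
    Set.disjoint_left.1 (hdisj hij) h (hmem j t)
  have hcolumn : ∀ (f : ℝ → ℝ), Continuous f → ∀ i j,
      IntervalIntegrable (fun s => (∫ t in (0:ℝ)..(2*π), Kker γ i j s t * f t) * ‖deriv (γ i) s‖)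
        volume 0 (2 * π) ∧
      ∫ s in (0:ℝ)..(2*π), (∫ t in (0:ℝ)..(2*π), Kker γ i j s t * f t) * ‖deriv (γ i) s‖
        = if i = j then -(1/2) * ∫ t in (0:ℝ)..(2*π), f t * ‖deriv (γ j) t‖ else 0 := by
    intro f hf i j
    have hb : ∃ C, ∀ s ∈ Set.Icc 0 (2 * π), ∀ t ∈ Set.Icc 0 (2 * π),
        |angularVelocity (planeToComplex ∘ γ i) ((planeToComplex ∘ γ j) t) s| ≤ C := by
      rcases eq_or_ne i j with rfl | hij
      · exact (hcurve i).exists_abs_angularVelocity_le _ _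
      · refine exists_abs_angularVelocity_le_of_disjoint (hcurve i) (hcurve j).continuous ?_ _ _
        intro s t h
        exact hne i j hij t (planeToComplex.injective h ▸ hmem i s)
    have hrw : ∀ s, (∫ t in (0:ℝ)..(2*π), Kker γ i j s t * f t) * ‖deriv (γ i) s‖
        = -(1 / (2 * π)) * ∫ t in (0:ℝ)..(2*π),
          angularVelocity (planeToComplex ∘ γ i) ((planeToComplex ∘ γ j) t) s
            * (f t * ‖deriv (γ j) t‖) := fun s => by
      rw [← intervalIntegral.integral_mul_const, ← intervalIntegral.integral_const_mul]
      congr 1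
      ext t
      rw [mul_right_comm, Kker_mul_norm_deriv i j s t (hdiff i s) (hreg i s), Function.comp_apply]
      ring
    obtain ⟨h1, h2⟩ := (hcurve i).integral_integral_angularVelocity_mul (hcurve j).continuous
      (f := fun t => f t * ‖deriv (γ j) t‖) (hf.mul (hspeed j)) hb
    simp only [hrw]
    refine ⟨h1.const_mul _, ?_⟩
    rw [intervalIntegral.integral_const_mul, h2]
    split_ifs with hij
    · subst hij
      simp only [Function.comp_apply, (hgauss i).2, intervalIntegral.integral_const_mul]
      have := pi_ne_zero
      field_simp
    · simp only [Function.comp_apply, (hgauss i).1 _ (hne i j hij _), zero_mul,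
        intervalIntegral.integral_zero, mul_zero]
  have hcancel : ∀ (f : Fin N → ℝ → ℝ), (∀ j, Continuous (f j)) → ∀ i,
      IntervalIntegrable (fun s => ((1/2) * f i s
        + ∑ j, ∫ t in (0:ℝ)..(2*π), Kker γ i j s t * f j t) * ‖deriv (γ i) s‖)
        volume 0 (2 * π) ∧
      ∫ s in (0:ℝ)..(2*π), ((1/2) * f i s
        + ∑ j, ∫ t in (0:ℝ)..(2*π), Kker γ i j s t * f j t) * ‖deriv (γ i) s‖ = 0 := by
    intro f hf i
    have hdiag : IntervalIntegrable (fun s => (1/2) * (f i s * ‖deriv (γ i) s‖))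
        volume 0 (2 * π) :=
      (continuous_const.mul ((hf i).mul (hspeed i))).intervalIntegrable _ _
    have hsum : IntervalIntegrable (fun s => ∑ j,
        (∫ t in (0:ℝ)..(2*π), Kker γ i j s t * f j t) * ‖deriv (γ i) s‖) volume 0 (2 * π) := by
      have := IntervalIntegrable.sum Finset.univ fun j _ => (hcolumn (f j) (hf j) i j).1
      refine this.congr fun s _ => ?_
      simp
    simp only [add_mul, Finset.sum_mul, mul_assoc (1/2 : ℝ)]
    refine ⟨hdiag.add hsum, ?_⟩
    rw [intervalIntegral.integral_add hdiag hsum, intervalIntegral.integral_finsetSum fun j _ =>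
      (hcolumn (f j) (hf j) i j).1, intervalIntegral.integral_const_mul]
    simp only [fun j => (hcolumn (f j) (hf j) i j).2, Finset.sum_ite_eq, Finset.mem_univ, if_true]
    ring
  have hcharge : ∀ i, ∫ t in (0:ℝ)..(2*π), μ i t * ‖deriv (γ i) t‖ = 0 := by
    intro i
    obtain ⟨hμ1, hμ2⟩ := hcancel μ hμc i
    obtain ⟨hσ1, hσ2⟩ := hcancel σ hσc i
    set A := ∫ t in (0:ℝ)..(2*π), μ i t * ‖deriv (γ i) t‖ with hA
    have hlength : 0 < ∫ s in (0:ℝ)..(2*π), ‖deriv (γ i) s‖ :=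
      intervalIntegral.intervalIntegral_pos_of_pos ((hspeed i).intervalIntegrable _ _)
        (fun s => norm_pos_iff.2 (hreg i s)) two_pi_pos
    have hpoint : ∀ s, A * ‖deriv (γ i) s‖
        = -(((1/2) * σ i s + ∑ j, ∫ t in (0:ℝ)..(2*π), Kker γ i j s t * σ j t)
            * ‖deriv (γ i) s‖
          + ((1/2) * μ i s + ∑ j, ∫ t in (0:ℝ)..(2*π), Kker γ i j s t * μ j t)
            * ‖deriv (γ i) s‖) := fun s => by
      linear_combination ‖deriv (γ i) s‖ * heq i s
    have hzero : A * ∫ s in (0:ℝ)..(2*π), ‖deriv (γ i) s‖ = 0 := by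
      rw [← intervalIntegral.integral_const_mul]
      simp only [hpoint]
      rw [intervalIntegral.integral_neg, intervalIntegral.integral_add hσ1 hμ1, hσ2, hμ2]
      ring
    exact (mul_eq_zero.1 hzero).resolve_right hlength.ne'
  refine ⟨hcharge, fun i s => ?_⟩
  have h := heq i s
  rwa [hcharge i, add_zero] at h
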